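/- For every n ≥ 0, the n-qubit real Clifford group C_n equals the extended gate group G_n'; that is, the set of orthogonal 2^n × 2^n matrices U such that U P U⁻¹ ∈ P_n for all P ∈ P_n coincides with the subgroup of GL(2^n, ℝ) generated by −I together with all H-gates, Z-gates, and CZ-gates on n qubits. -/

import Mathlib

open Matrix

noncomputable section

namespace RealStab

abbrev Mat (n : ℕ) := Matrix (Fin n → Fin 2) (Fin n → Fin 2) ℝ

/-- The real Pauli matrix `X`. -/
def X2 : Matrix (Fin 2) (Fin 2) ℝ := !![0, 1; 1, 0]

/-- The real Pauli matrix `Z`. -/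
def Z2 : Matrix (Fin 2) (Fin 2) ℝ := !![1, 0; 0, -1]

/-- The set `{I, X, Z, XZ}` of single-qubit Pauli matrices. -/
def pauliSet : Set (Matrix (Fin 2) (Fin 2) ℝ) := {1, X2, Z2, X2 * Z2}

/-- The `n`-fold Kronecker (tensor) product `P 0 ⊗ ⋯ ⊗ P (n-1)`, represented as a
matrix indexed by functions `Fin n → Fin 2` (a `2^n × 2^n` matrix). -/
def tensorN {n : ℕ} (P : Fin n → Matrix (Fin 2) (Fin 2) ℝ) : Mat n :=
  Matrix.of fun x y => ∏ i, P i (x i) (y i)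

/-- The `n`-qubit real Pauli group `P_n`, as a set of `2^n × 2^n` real matrices. -/
def PauliGroup (n : ℕ) : Set (Mat n) :=
  { M | ∃ a : Fin 2, ∃ P : Fin n → Matrix (Fin 2) (Fin 2) ℝ,
      (∀ i, P i ∈ pauliSet) ∧ M = (-1 : ℝ) ^ (a : ℕ) • tensorN P }


/-- The `n`-qubit real Clifford group `C_n`: orthogonal matrices normalizing `P_n`. -/
def CliffordGroup (n : ℕ) : Set (Mat n) :=
  { U | U ∈ Matrix.orthogonalGroup (Fin n → Fin 2) ℝ ∧
        ∀ P ∈ PauliGroup n, U * P * U⁻¹ ∈ PauliGroup n }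

/-- The Hadamard matrix `H = (1/√2)·!![1,1;1,−1]`. -/
def Hmat : Matrix (Fin 2) (Fin 2) ℝ := (Real.sqrt 2)⁻¹ • !![1, 1; 1, -1]

/-- The single-qubit gate `G` applied on qubit `i`: the Kronecker product
`I^{⊗(i-1)} ⊗ G ⊗ I^{⊗(n-i)}`. -/
def gate1 {n : ℕ} (i : Fin n) (G : Matrix (Fin 2) (Fin 2) ℝ) : Mat n :=
  tensorN (fun j => if j = i then G else 1)

/-- The controlled-Z gate on qubits `i` and `j`: diagonal, with entry `−1` exactly
on basis states where both bits `i` and `j` equal `1`. For `j = i+1` this is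
`I^{⊗(i-1)} ⊗ CZ ⊗ I^{⊗(n-i-1)}` with `CZ = diag(1,1,1,−1)`. -/
def CZgate {n : ℕ} (i j : Fin n) : Mat n :=
  Matrix.diagonal (fun x => if x i = 1 ∧ x j = 1 then -1 else 1)

/-- The set of generating gate matrices: `H`-gates and `Z`-gates on each qubit, and
`CZ`-gates on adjacent pairs of qubits. -/
def gateSet (n : ℕ) : Set (Mat n) :=
  { M | (∃ i : Fin n, M = gate1 i Hmat) ∨ (∃ i : Fin n, M = gate1 i Z2) ∨
        (∃ i : Fin n, ∃ h : (i : ℕ) + 1 < n, M = CZgate i ⟨(i : ℕ) + 1, h⟩) }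

/-- The gate group `G_n`: the subgroup of `GL(2^n, ℝ)` (units of the matrix ring)
generated by all `H`-gates, `Z`-gates and `CZ`-gates. -/
def GateGroup (n : ℕ) : Subgroup (Mat n)ˣ :=
  Subgroup.closure { U : (Mat n)ˣ | (U : Mat n) ∈ gateSet n }

/-- The extended gate group `G_n'`: the subgroup of `GL(2^n, ℝ)` generated by `−I`
together with all `H`-gates, `Z`-gates and `CZ`-gates. -/
def ExtGateGroup (n : ℕ) : Subgroup (Mat n)ˣ :=
  Subgroup.closure ({ U : (Mat n)ˣ | (U : Mat n) ∈ gateSet n } ∪ {(-1 : (Mat n)ˣ)})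

/-- The sign `(-1) ^ a` for `a` in `ZMod 2`. -/
def sgn (a : ZMod 2) : ℝ := if a = 0 then 1 else -1

@[simp] lemma sgn_zero : sgn 0 = 1 := if_pos rfl

@[simp] lemma sgn_one : sgn 1 = -1 := if_neg one_ne_zero

lemma zmod_two_cases (a : ZMod 2) : a = 0 ∨ a = 1 := by
  revert a; decide

lemma sgn_add (a b : ZMod 2) : sgn (a + b) = sgn a * sgn b := by
  have h : (1 + 1 : ZMod 2) = 0 := rfl
  rcases zmod_two_cases a with rfl | rfl <;> rcases zmod_two_cases b with rfl | rfl <;>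
    simp [h]

@[simp] lemma sgn_mul_self (a : ZMod 2) : sgn a * sgn a = 1 := by
  rcases zmod_two_cases a with rfl | rfl <;> simp

lemma sgn_ne_zero (a : ZMod 2) : sgn a ≠ 0 := by
  rcases zmod_two_cases a with rfl | rfl <;> simp

lemma sgn_injective : Function.Injective sgn := by
  intro a b
  rcases zmod_two_cases a with rfl | rfl <;> rcases zmod_two_cases b with rfl | rfl <;>
    norm_num

lemma sgn_sum {ι : Type*} (s : Finset ι) (f : ι → ZMod 2) :
    sgn (∑ i ∈ s, f i) = ∏ i ∈ s, sgn (f i) := by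
  classical
  induction s using Finset.induction_on with
  | empty => simp
  | insert i s hi ih => rw [Finset.sum_insert hi, Finset.prod_insert hi, sgn_add, ih]

/-- Phase space: a pair of bits (the exponents of `X` and of `Z`) for every qubit. -/
abbrev Phase (n : ℕ) := Fin n → ZMod 2 × ZMod 2

/-- The single-qubit Pauli matrix `X ^ p.1 * Z ^ p.2`, by entries. -/
def pauli (p : ZMod 2 × ZMod 2) : Matrix (Fin 2) (Fin 2) ℝ :=
  Matrix.of fun x y : ZMod 2 => if x = y + p.1 then sgn (p.2 * y) else 0

lemma pauli_apply (p : ZMod 2 × ZMod 2) (x y : ZMod 2) :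
    pauli p x y = if x = y + p.1 then sgn (p.2 * y) else 0 := rfl

lemma matrix_ext_zmod {A B : Matrix (Fin 2) (Fin 2) ℝ}
    (h : ∀ x y : ZMod 2, A x y = B x y) : A = B :=
  Matrix.ext h

lemma pauli_zero : pauli 0 = 1 := by
  refine matrix_ext_zmod fun x y => ?_
  rw [pauli_apply, Prod.fst_zero, Prod.snd_zero, add_zero, zero_mul, sgn_zero]
  exact (Matrix.one_apply (i := x) (j := y)).symm

lemma pauli_X : pauli (1, 0) = X2 := by
  refine matrix_ext_zmod fun x y => ?_
  rcases zmod_two_cases x with rfl | rfl <;> rcases zmod_two_cases y with rfl | rfl <;>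
    simp [pauli_apply, CharTwo.add_self_eq_zero] <;> rfl

lemma pauli_Z : pauli (0, 1) = Z2 := by
  refine matrix_ext_zmod fun x y => ?_
  rcases zmod_two_cases x with rfl | rfl <;> rcases zmod_two_cases y with rfl | rfl <;>
    simp [pauli_apply] <;> rfl

lemma pauli_mul (p q : ZMod 2 × ZMod 2) :
    pauli p * pauli q = sgn (p.2 * q.1) • pauli (p + q) := by
  refine matrix_ext_zmod fun x y => ?_
  change ∑ z : ZMod 2, pauli p x z * pauli q z y = sgn (p.2 * q.1) * pauli (p + q) x y
  rw [Finset.sum_eq_single_of_mem (y + q.1 : ZMod 2) (Finset.mem_univ _)]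
  · simp only [pauli_apply, Prod.fst_add, Prod.snd_add]
    rw [if_pos trivial]
    have h : y + q.1 + p.1 = y + (p.1 + q.1) := by ring
    rw [h]
    split_ifs
    · rw [← sgn_add, ← sgn_add]
      congr 1
      ring
    · simp
  · intro z _ hz
    rw [pauli_apply q, if_neg hz, mul_zero]

lemma Hmat_mul_self : Hmat * Hmat = 1 := by
  have h : (√2 : ℝ)⁻¹ * (√2)⁻¹ = 1 / 2 := by
    rw [← mul_inv, Real.mul_self_sqrt (by norm_num)]; norm_num
  ext x y
  fin_cases x <;> fin_cases y <;>
    simp [Hmat, Matrix.mul_apply, Fin.sum_univ_two, h] <;> norm_num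

lemma Hmat_transpose : Hmatᵀ = Hmat := by
  ext x y
  fin_cases x <;> fin_cases y <;> simp [Hmat]

lemma Hmat_mul_pauli (p : ZMod 2 × ZMod 2) :
    Hmat * pauli p = sgn (p.1 * p.2) • (pauli p.swap * Hmat) := by
  have hx : Hmat * X2 = Z2 * Hmat := by
    ext x y
    fin_cases x <;> fin_cases y <;>
      simp [Hmat, X2, Z2, Matrix.mul_apply, Fin.sum_univ_two]
  have hz : Hmat * Z2 = X2 * Hmat := by
    ext x y
    fin_cases x <;> fin_cases y <;>
      simp [Hmat, X2, Z2, Matrix.mul_apply, Fin.sum_univ_two]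
  obtain ⟨a, b⟩ := p
  rcases zmod_two_cases a with rfl | rfl <;> rcases zmod_two_cases b with rfl | rfl
  · have h := pauli_zero
    change pauli (0, 0) = 1 at h
    simp [h]
  · simp [pauli_X, pauli_Z, hz]
  · simp [pauli_X, pauli_Z, hx]
  · have h1 := pauli_mul (1, 0) (0, 1)
    have h2 := pauli_mul (0, 1) (1, 0)
    simp only [pauli_X, pauli_Z, mul_zero, sgn_zero, one_smul, Prod.mk_add_mk, add_zero,
      zero_add, mul_one, sgn_one] at h1 h2
    simp only [mul_one, sgn_one, Prod.swap_prod_mk]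
    rw [← h1, ← mul_assoc, hx, mul_assoc, hz, ← mul_assoc, h2, h1]
    simp

lemma mem_pauliSet_iff (M : Matrix (Fin 2) (Fin 2) ℝ) :
    M ∈ pauliSet ↔ ∃ p, M = pauli p := by
  have h1 := pauli_mul (1, 0) (0, 1)
  simp only [pauli_X, pauli_Z, mul_zero, sgn_zero, one_smul, Prod.mk_add_mk, add_zero,
      zero_add] at h1
  have h0 := pauli_zero
  change pauli (0, 0) = 1 at h0
  simp only [pauliSet, Set.mem_insert_iff, Set.mem_singleton_iff]
  constructor
  · rintro (rfl | rfl | rfl | rfl)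
    exacts [⟨_, h0.symm⟩, ⟨_, pauli_X.symm⟩, ⟨_, pauli_Z.symm⟩, ⟨_, h1⟩]
  · rintro ⟨⟨a, b⟩, rfl⟩
    rcases zmod_two_cases a with rfl | rfl <;> rcases zmod_two_cases b with rfl | rfl
    · exact .inl h0
    · exact .inr (.inr (.inl pauli_Z))
    · exact .inr (.inl pauli_X)
    · exact .inr (.inr (.inr h1.symm))

variable {n : ℕ}

lemma tensorN_mul (P Q : Fin n → Matrix (Fin 2) (Fin 2) ℝ) :
    tensorN P * tensorN Q = tensorN fun i => P i * Q i := by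
  ext x y
  simp only [tensorN, Matrix.mul_apply, Matrix.of_apply, ← Finset.prod_mul_distrib]
  rw [Finset.prod_univ_sum, Fintype.piFinset_univ]

lemma tensorN_smul (c : Fin n → ℝ) (P : Fin n → Matrix (Fin 2) (Fin 2) ℝ) :
    tensorN (fun i => c i • P i) = (∏ i, c i) • tensorN P := by
  ext x y
  simp [tensorN, Finset.prod_mul_distrib]

lemma tensorN_one : tensorN (fun _ : Fin n => (1 : Matrix (Fin 2) (Fin 2) ℝ)) = 1 := by
  ext x y
  simp only [tensorN, Matrix.of_apply, Matrix.one_apply, funext_iff]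
  rw [Finset.prod_ite_zero]
  simp

lemma tensorN_transpose (P : Fin n → Matrix (Fin 2) (Fin 2) ℝ) :
    (tensorN P)ᵀ = tensorN fun i => (P i)ᵀ := rfl

/-- The Pauli operator with the given phase-space coordinates. -/
def weyl (v : Phase n) : Mat n := tensorN fun i => pauli (v i)

/-- The exponent of the cocycle of `weyl`. -/
def cocycle (v w : Phase n) : ZMod 2 := ∑ i, (v i).2 * (w i).1

/-- The symplectic form on phase space. -/
def symp (v w : Phase n) : ZMod 2 := ∑ i, ((v i).1 * (w i).2 + (v i).2 * (w i).1)

/-- The quadratic form on phase space. -/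
def quad (v : Phase n) : ZMod 2 := ∑ i, (v i).1 * (v i).2

lemma phase_add_self (v : Phase n) : v + v = 0 := by
  ext i <;> exact CharTwo.add_self_eq_zero _

lemma symp_eq_cocycle_add (v w : Phase n) : symp v w = cocycle v w + cocycle w v := by
  simp only [symp, cocycle, ← Finset.sum_add_distrib]
  exact Finset.sum_congr rfl fun i _ => by ring

lemma quad_add (v w : Phase n) : quad (v + w) = quad v + quad w + symp v w := by
  simp only [symp, quad, ← Finset.sum_add_distrib]
  exact Finset.sum_congr rfl fun i _ => by
    simp only [Pi.add_apply, Prod.fst_add, Prod.snd_add]; ring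

lemma symp_add_left (u v w : Phase n) : symp (u + v) w = symp u w + symp v w := by
  simp only [symp, ← Finset.sum_add_distrib]
  exact Finset.sum_congr rfl fun i _ => by
    simp only [Pi.add_apply, Prod.fst_add, Prod.snd_add]; ring

lemma symp_comm (v w : Phase n) : symp v w = symp w v := by
  rw [symp_eq_cocycle_add, symp_eq_cocycle_add, add_comm]

lemma symp_add_right (u v w : Phase n) : symp u (v + w) = symp u v + symp u w := by
  rw [symp_comm, symp_add_left, symp_comm v, symp_comm w]

lemma symp_single_right (v : Phase n) (i : Fin n) (p : ZMod 2 × ZMod 2) :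
    symp v (Pi.single i p) = (v i).1 * p.2 + (v i).2 * p.1 := by
  rw [symp, Finset.sum_eq_single_of_mem i (Finset.mem_univ _)]
  · simp
  · intro j _ hj
    simp [hj]

lemma quad_single (i : Fin n) (p : ZMod 2 × ZMod 2) :
    quad (Pi.single i p) = p.1 * p.2 := by
  rw [quad, Finset.sum_eq_single_of_mem i (Finset.mem_univ _)]
  · simp
  · intro j _ hj
    simp [hj]

lemma weyl_zero : weyl (0 : Phase n) = 1 := by
  simp [weyl, pauli_zero, tensorN_one]

lemma weyl_mul (v w : Phase n) :
    weyl v * weyl w = sgn (cocycle v w) • weyl (v + w) := by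
  simp only [weyl, tensorN_mul, pauli_mul, tensorN_smul, cocycle, sgn_sum, Pi.add_apply]

lemma weyl_mul_comm (v w : Phase n) :
    weyl v * weyl w = sgn (symp v w) • (weyl w * weyl v) := by
  rw [weyl_mul, weyl_mul, symp_eq_cocycle_add, sgn_add, smul_smul, mul_assoc, sgn_mul_self,
    mul_one, add_comm v]

lemma weyl_mul_self (v : Phase n) : weyl v * weyl v = sgn (quad v) • 1 := by
  rw [weyl_mul, phase_add_self, weyl_zero, cocycle, quad]
  simp only [mul_comm]

lemma weyl_apply (v : Phase n) (x y : Fin n → ZMod 2) :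
    weyl v x y = if ∀ i, x i = y i + (v i).1 then sgn (∑ i, (v i).2 * y i) else 0 := by
  have h : weyl v x y = ∏ i, pauli (v i) (x i) (y i) := rfl
  simp only [h, pauli_apply]
  rw [Finset.prod_ite_zero, sgn_sum]
  simp

lemma weyl_single (i : Fin n) (p : ZMod 2 × ZMod 2) :
    weyl (Pi.single i p) = gate1 i (pauli p) := by
  unfold weyl gate1
  congr 1
  ext1 j
  by_cases h : j = i
  · subst h; simp
  · simp [h, pauli_zero]

/-- `weyl` separates phase-space points, even up to sign. -/
lemma eq_of_weyl_eq_smul {v w : Phase n} {c : ℝ} (h : weyl v = c • weyl w) :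
    v = w := by
  have key : ∀ y : Fin n → ZMod 2,
      (∀ i, (v i).1 = (w i).1) ∧
        sgn (∑ i, (v i).2 * y i) = c * sgn (∑ i, (w i).2 * y i) := by
    intro y
    have h1 := congrFun (congrFun h (fun i => y i + (v i).1)) y
    change _ = c * weyl w (fun i => y i + (v i).1) y at h1
    rw [weyl_apply, weyl_apply, if_pos fun _ => rfl] at h1
    split_ifs at h1 with h2
    · exact ⟨fun i => add_left_cancel (h2 i), h1⟩
    · simp [sgn_ne_zero] at h1
  have hc : c = 1 := by simpa using (key 0).2.symm
  ext i
  · exact (key 0).1 i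
  · have := sgn_injective (by simpa [hc] using (key (Pi.single i 1)).2)
    simpa [Pi.single_apply] using this

lemma mem_PauliGroup_iff (M : Mat n) :
    M ∈ PauliGroup n ↔ ∃ s v, M = sgn s • weyl v := by
  constructor
  · rintro ⟨a, P, hP, rfl⟩
    choose v hv using fun i => (mem_pauliSet_iff _).1 (hP i)
    refine ⟨if a = 0 then 0 else 1, v, ?_⟩
    have hP' : P = fun i => pauli (v i) := funext hv
    rw [hP', weyl]
    congr 1
    fin_cases a <;> simp
  · rintro ⟨s, v, rfl⟩
    refine ⟨if s = 0 then 0 else 1, fun i => pauli (v i),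
      fun i => (mem_pauliSet_iff _).2 ⟨_, rfl⟩, ?_⟩
    rw [weyl]
    congr 1
    rcases zmod_two_cases s with rfl | rfl <;> simp

/-- Induction along the standard symplectic basis of phase space. -/
lemma phase_induction {p : Phase n → Prop} (zero : p 0)
    (hadd : ∀ v w, p v → p w → p (v + w))
    (x : ∀ i, p (Pi.single i (1, 0))) (z : ∀ i, p (Pi.single i (0, 1))) (v : Phase n) :
    p v := by
  rw [← Finset.univ_sum_single v]
  refine Finset.sum_induction _ p hadd zero fun i _ => ?_
  obtain ⟨a, b⟩ := v i
  have h : (Pi.single i (a, b) : Phase n) = Pi.single i (a, 0) + Pi.single i (0, b) := by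
    rw [← Pi.single_add]; simp
  have h0 : (Pi.single i (0, 0) : Phase n) = 0 := Pi.single_zero i
  rw [h]
  refine hadd _ _ ?_ ?_
  · rcases zmod_two_cases a with rfl | rfl
    exacts [h0 ▸ zero, x i]
  · rcases zmod_two_cases b with rfl | rfl
    exacts [h0 ▸ zero, z i]

/-- Conjugation by `U` acts on Pauli operators, up to sign, through the map `f` of phase space. -/
def IsAct (U : Mat n) (f : Phase n → Phase n) : Prop :=
  ∃ s : Phase n → ZMod 2, ∀ v, U * weyl v = sgn (s v) • (weyl (f v) * U)

lemma IsAct.comp {U V : Mat n} {f g : Phase n → Phase n} (hU : IsAct U f) (hV : IsAct V g) :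
    IsAct (U * V) (f ∘ g) := by
  obtain ⟨s, hs⟩ := hU
  obtain ⟨t, ht⟩ := hV
  refine ⟨fun v => t v + s (g v), fun v => ?_⟩
  rw [mul_assoc, ht, mul_smul_comm, ← mul_assoc, hs, smul_mul_assoc, smul_smul, sgn_add,
    mul_assoc]
  rfl

lemma isAct_one : IsAct (1 : Mat n) id :=
  ⟨0, fun v => by simp⟩

lemma isAct_neg_one : IsAct (-1 : Mat n) id :=
  ⟨0, fun v => by simp⟩

lemma isAct_weyl (q : Phase n) : IsAct (weyl q) id :=
  ⟨symp q, weyl_mul_comm q⟩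

section Preserve

variable {U : (Mat n)ˣ} {f : Phase n → Phase n}

lemma IsAct.map_add (h : IsAct (U : Mat n) f) (v w : Phase n) : f (v + w) = f v + f w := by
  obtain ⟨s, hs⟩ := h
  have h1 : (U : Mat n) * (weyl v * weyl w) =
      (sgn (s v) * sgn (s w) * sgn (cocycle (f v) (f w))) • (weyl (f v + f w) * U) := by
    rw [← mul_assoc, hs, smul_mul_assoc, mul_assoc, hs, mul_smul_comm, ← mul_assoc, weyl_mul,
      smul_mul_assoc, smul_smul, smul_smul, mul_assoc]
  rw [weyl_mul, mul_smul_comm, hs, smul_smul, ← smul_mul_assoc, ← smul_mul_assoc,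
    Units.mul_left_inj, ← sgn_add, ← sgn_add, ← sgn_add] at h1
  set a := cocycle v w + s (v + w)
  have h2 := congrArg (fun M => sgn a • M) h1
  simp only [smul_smul, sgn_mul_self, one_smul] at h2
  exact eq_of_weyl_eq_smul h2

lemma IsAct.quad_map (h : IsAct (U : Mat n) f) (v : Phase n) : quad (f v) = quad v := by
  obtain ⟨s, hs⟩ := h
  have h1 : (U : Mat n) * (weyl v * weyl v) = sgn (quad (f v)) • (U : Mat n) := by
    rw [← mul_assoc, hs, smul_mul_assoc, mul_assoc, hs, mul_smul_comm, ← mul_assoc,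
      weyl_mul_self, smul_smul, sgn_mul_self, one_smul, smul_one_mul]
  rw [weyl_mul_self, mul_smul_comm, mul_one] at h1
  exact (sgn_injective (smul_left_injective ℝ U.ne_zero h1)).symm

lemma IsAct.symp_map (h : IsAct (U : Mat n) f) (v w : Phase n) :
    symp (f v) (f w) = symp v w := by
  have h1 := quad_add (f v) (f w)
  rw [← h.map_add, h.quad_map, h.quad_map, h.quad_map, quad_add] at h1
  exact (add_left_cancel h1).symm

end Preserve

/-- The phase-space action of an `H`-gate. -/
def hadMap (i : Fin n) (v : Phase n) : Phase n := Function.update v i (v i).swap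

/-- The phase-space action of a `CZ`-gate. -/
def czMap (i j : Fin n) (v : Phase n) : Phase n :=
  v + Pi.single i (0, (v j).1) + Pi.single j (0, (v i).1)

lemma isAct_gate1_Hmat (i : Fin n) : IsAct (gate1 i Hmat) (hadMap i) := by
  refine ⟨fun v => ∑ j, if j = i then (v j).1 * (v j).2 else 0, fun v => ?_⟩
  rw [gate1, weyl, weyl, tensorN_mul, tensorN_mul, sgn_sum, ← tensorN_smul]
  congr 1
  ext1 j
  by_cases h : j = i
  · subst h
    simp [hadMap, Hmat_mul_pauli]
  · simp [hadMap, h]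

lemma isAct_CZgate (i j : Fin n) (hij : i ≠ j) : IsAct (CZgate i j) (czMap i j) := by
  refine ⟨fun v => (v i).1 * (v j).1, fun v => Matrix.ext fun x y => ?_⟩
  have hd : ∀ z : Fin n → ZMod 2,
      (if z i = 1 ∧ z j = 1 then -1 else 1 : ℝ) = sgn (z i * z j) := by
    intro z
    rcases zmod_two_cases (z i) with h | h <;> rcases zmod_two_cases (z j) with h' | h' <;>
      simp [h, h']
  have key : ∀ x y : Fin n → ZMod 2,
      (if x i = 1 ∧ x j = 1 then -1 else 1 : ℝ) * weyl v x y = sgn ((v i).1 * (v j).1) *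
        (weyl (czMap i j v) x y * (if y i = 1 ∧ y j = 1 then -1 else 1 : ℝ)) := by
    intro x y
    rw [hd, hd]
    have hc : ∀ k, (czMap i j v k).1 = (v k).1 := by
      intro k
      by_cases h1 : k = i <;> by_cases h2 : k = j <;> simp_all [czMap]
    have hs : ∑ k, (czMap i j v k).2 * y k =
        ∑ k, (v k).2 * y k + (v j).1 * y i + (v i).1 * y j := by
      have : ∀ k, (czMap i j v k).2 * y k = (v k).2 * y k +
          (Pi.single i (((v j).1) * y i) : Fin n → ZMod 2) k +
          (Pi.single j (((v i).1) * y j) : Fin n → ZMod 2) k := by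
        intro k
        by_cases h1 : k = i
        · subst h1
          simp [czMap, hij, add_mul]
        · by_cases h2 : k = j
          · subst h2
            simp [czMap, h1, add_mul]
          · simp [czMap, h1, h2]
      simp only [this, Finset.sum_add_distrib, Finset.sum_pi_single', Finset.mem_univ, if_true]
    simp only [weyl_apply, hc, hs]
    split_ifs with h
    · rw [← sgn_add, ← sgn_add, ← sgn_add, h i, h j]
      congr 1
      ring
    · simp
  simp only [CZgate, Matrix.diagonal_mul]
  refine (key x y).trans ?_
  exact congrArg (sgn _ * ·) (Matrix.mul_diagonal
    (fun z => if z i = 1 ∧ z j = 1 then -1 else 1) (weyl (czMap i j v)) x y).symm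

lemma gate1_transpose (i : Fin n) (G : Matrix (Fin 2) (Fin 2) ℝ) (hG : Gᵀ = G) :
    (gate1 i G)ᵀ = gate1 i G := by
  rw [gate1, tensorN_transpose]
  congr 1
  ext1 j
  split_ifs
  exacts [hG, Matrix.transpose_one]

lemma gate1_mul_self (i : Fin n) (G : Matrix (Fin 2) (Fin 2) ℝ) (hG : G * G = 1) :
    gate1 i G * gate1 i G = 1 := by
  rw [gate1, tensorN_mul, ← tensorN_one]
  congr 1
  ext1 j
  split_ifs
  exacts [hG, mul_one 1]

lemma Z2_mul_self : Z2 * Z2 = 1 := by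
  ext x y
  fin_cases x <;> fin_cases y <;> simp [Z2, Matrix.mul_apply, Fin.sum_univ_two]

lemma gateSet_spec {M : Mat n} (hM : M ∈ gateSet n) :
    Mᵀ = M ∧ M * M = 1 ∧ ∃ f, IsAct M f := by
  rcases hM with ⟨i, rfl⟩ | ⟨i, rfl⟩ | ⟨i, h, rfl⟩
  · exact ⟨gate1_transpose i _ Hmat_transpose, gate1_mul_self i _ Hmat_mul_self, _,
      isAct_gate1_Hmat i⟩
  · refine ⟨gate1_transpose i _ ?_, gate1_mul_self i _ Z2_mul_self, id, ?_⟩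
    · ext x y
      fin_cases x <;> fin_cases y <;> simp [Z2]
    · rw [← pauli_Z, ← weyl_single]
      exact isAct_weyl _
  · refine ⟨Matrix.diagonal_transpose _, ?_, _, isAct_CZgate i _ ?_⟩
    · rw [CZgate, Matrix.diagonal_mul_diagonal, ← Matrix.diagonal_one]
      congr 1
      ext1 x
      split_ifs <;> simp
    · simp [Fin.ext_iff]

lemma exists_mem_extGateGroup {M : Mat n} (hM : M ∈ gateSet n) :
    ∃ g ∈ ExtGateGroup n, (g : Mat n) = M :=
  ⟨⟨M, M, (gateSet_spec hM).2.1, (gateSet_spec hM).2.1⟩,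
    Subgroup.subset_closure (.inl hM), rfl⟩

lemma neg_one_mem_extGateGroup : (-1 : (Mat n)ˣ) ∈ ExtGateGroup n :=
  Subgroup.subset_closure (.inr rfl)

lemma extGateGroup_spec {g : (Mat n)ˣ} (hg : g ∈ ExtGateGroup n) :
    (g : Mat n) ∈ Matrix.orthogonalGroup (Fin n → Fin 2) ℝ ∧ ∃ f, IsAct (g : Mat n) f := by
  have gen : ∀ g : (Mat n)ˣ, g ∈ ({ U : (Mat n)ˣ | (U : Mat n) ∈ gateSet n } ∪ {-1}) →
      (g : Mat n)ᵀ = g ∧ (g : Mat n) * g = 1 ∧ ∃ f, IsAct (g : Mat n) f := by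
    rintro g (hg | rfl)
    · exact gateSet_spec hg
    · exact ⟨by simp, by simp, id, by simpa using isAct_neg_one⟩
  have gen' : ∀ g : (Mat n)ˣ, g ∈ ({ U : (Mat n)ˣ | (U : Mat n) ∈ gateSet n } ∪ {-1}) →
      (g : Mat n) ∈ Matrix.orthogonalGroup (Fin n → Fin 2) ℝ ∧ ∃ f, IsAct (g : Mat n) f := by
    intro g hg
    obtain ⟨h1, h2, h3⟩ := gen g hg
    refine ⟨?_, h3⟩
    rw [Matrix.mem_orthogonalGroup_iff, h1, h2]
  induction hg using Subgroup.closure_induction'' with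
  | mem g hg => exact gen' g hg
  | inv_mem g hg =>
    have : g⁻¹ = g := inv_eq_of_mul_eq_one_left (Units.ext (gen g hg).2.1)
    rw [this]
    exact gen' g hg
  | one => exact ⟨one_mem _, id, isAct_one⟩
  | mul g h _ _ hg hh =>
    obtain ⟨hg, f, hf⟩ := hg
    obtain ⟨hh, f', hf'⟩ := hh
    exact ⟨mul_mem hg hh, _, hf.comp hf'⟩

/-- The maps of phase space induced by elements of the extended gate group. -/
def realized (n : ℕ) : Set (Phase n → Phase n) :=
  { f | ∃ g ∈ ExtGateGroup n, IsAct (g : Mat n) f }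

lemma realized_comp {f g : Phase n → Phase n} (hf : f ∈ realized n) (hg : g ∈ realized n) :
    f ∘ g ∈ realized n := by
  obtain ⟨a, ha, hf⟩ := hf
  obtain ⟨b, hb, hg⟩ := hg
  exact ⟨a * b, mul_mem ha hb, hf.comp hg⟩

lemma id_mem_realized : id ∈ realized n := ⟨1, one_mem _, isAct_one⟩

lemma hadMap_mem_realized (i : Fin n) : hadMap i ∈ realized n := by
  obtain ⟨g, hg, h⟩ := exists_mem_extGateGroup (n := n) (.inl ⟨i, rfl⟩)
  exact ⟨g, hg, h ▸ isAct_gate1_Hmat i⟩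

lemma czMap_succ_mem_realized (i : Fin n) (h : (i : ℕ) + 1 < n) :
    czMap i ⟨i + 1, h⟩ ∈ realized n := by
  obtain ⟨g, hg, h'⟩ := exists_mem_extGateGroup (n := n) (.inr (.inr ⟨i, h, rfl⟩))
  exact ⟨g, hg, h' ▸ isAct_CZgate i _ (by simp [Fin.ext_iff])⟩

/-- The map of phase space interchanging two qubits. -/
def swapMap (i j : Fin n) (v : Phase n) : Phase n := v ∘ Equiv.swap i j

lemma swapMap_eq (i j : Fin n) (hij : i ≠ j) :
    swapMap i j = (hadMap j ∘ czMap i j ∘ hadMap j) ∘ (hadMap i ∘ czMap i j ∘ hadMap i) ∘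
      (hadMap j ∘ czMap i j ∘ hadMap j) := by
  have hji := hij.symm
  ext1 v
  ext1 k
  by_cases hi : k = i
  · subst hi
    simp [swapMap, hadMap, czMap, hij, hji, Prod.ext_iff]
    grind
  · by_cases hj : k = j
    · subst hj
      simp [swapMap, hadMap, czMap, hij, hji, Prod.ext_iff]
      grind
    · simp [swapMap, hadMap, czMap, hi, hj, Equiv.swap_apply_of_ne_of_ne]

lemma czMap_comm (i j : Fin n) : czMap i j = czMap j i := by
  ext1 v
  simp only [czMap]
  abel

lemma swapMap_czMap (i j k : Fin n) (hij : i ≠ j) (hik : i ≠ k) :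
    swapMap j k ∘ czMap i j ∘ swapMap j k = czMap i k := by
  ext1 v
  ext1 l
  by_cases hi : l = i
  · subst hi
    simp [swapMap, czMap, hij, hik, Equiv.swap_apply_of_ne_of_ne]
  · by_cases hj : l = j
    · subst hj
      by_cases hk : l = k
      · subst hk
        simp [swapMap, czMap, hij]
      · simp [swapMap, czMap, hi, hk, hik.symm]
    · by_cases hk : l = k
      · subst hk
        simp [swapMap, czMap, hi, hij, hik, Equiv.swap_apply_of_ne_of_ne]
      · simp [swapMap, czMap, hi, hj, hk, Equiv.swap_apply_of_ne_of_ne]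

lemma czMap_mem_realized (i j : Fin n) (hij : i ≠ j) : czMap i j ∈ realized n := by
  have adj : ∀ m : ℕ, ∀ h : m + 1 < n, swapMap ⟨m, by omega⟩ ⟨m + 1, h⟩ ∈ realized n := by
    intro m h
    have hc := czMap_succ_mem_realized ⟨m, by omega⟩ h
    rw [swapMap_eq _ _ (by simp)]
    have conj : ∀ k, hadMap k ∘ czMap ⟨m, by omega⟩ ⟨m + 1, h⟩ ∘ hadMap k ∈ realized n :=
      fun k => realized_comp (hadMap_mem_realized k)
        (realized_comp hc (hadMap_mem_realized k))
    exact realized_comp (conj _) (realized_comp (conj _) (conj _))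
  have main : ∀ (i : Fin n) (d : ℕ) (h : (i : ℕ) + 1 + d < n),
      czMap i ⟨i + 1 + d, h⟩ ∈ realized n := by
    intro i d
    induction d with
    | zero => exact fun h => czMap_succ_mem_realized i h
    | succ d ih =>
      intro h
      have hs := adj (i + 1 + d) h
      rw [← swapMap_czMap i ⟨i + 1 + d, by omega⟩ ⟨i + 1 + (d + 1), h⟩
        (by simp [Fin.ext_iff]; omega) (by simp [Fin.ext_iff]; omega)]
      exact realized_comp hs (realized_comp (ih _) hs)
  rcases lt_or_gt_of_ne hij with h | h
  · obtain ⟨d, hd⟩ := Nat.exists_eq_add_of_le (Nat.succ_le_of_lt (Fin.lt_def.1 h))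
    have hj : j = ⟨i + 1 + d, by omega⟩ := Fin.ext hd
    rw [hj]
    exact main i d _
  · obtain ⟨d, hd⟩ := Nat.exists_eq_add_of_le (Nat.succ_le_of_lt (Fin.lt_def.1 h))
    have hi : i = ⟨j + 1 + d, by omega⟩ := Fin.ext hd
    rw [czMap_comm, hi]
    exact main j d _

/-- The Eichler transformation attached to the `Z`-vector of qubit `k` and to `u`. -/
def eichler (k : Fin n) (u v : Phase n) : Phase n :=
  v + (v k).1 • u + Pi.single k (0, symp v u + quad u * (v k).1)

lemma symp_smul_left (c : ZMod 2) (v w : Phase n) : symp (c • v) w = c * symp v w := by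
  simp only [symp, Finset.mul_sum]
  exact Finset.sum_congr rfl fun i _ => by
    simp only [Pi.smul_apply, Prod.smul_fst, Prod.smul_snd, smul_eq_mul]; ring

lemma eichler_comp (k : Fin n) (u w : Phase n) (hu : u k = 0) (hw : w k = 0) :
    eichler k u ∘ eichler k w = eichler k (u + w) := by
  ext1 v
  have h1 : (eichler k w v k).1 = (v k).1 := by simp [eichler, hw]
  have h2 : symp (eichler k w v) u = symp v u + (v k).1 * symp u w := by
    rw [eichler, symp_add_left, symp_add_left, symp_smul_left, symp_comm (Pi.single _ _),
      symp_single_right, hu, symp_comm w u]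
    simp
  change eichler k w v + (eichler k w v k).1 • u +
    Pi.single k (0, symp (eichler k w v) u + quad u * (eichler k w v k).1) = _
  rw [h1, h2, eichler, eichler, quad_add, symp_add_right, smul_add]
  have h3 : (0, symp v u + symp v w + (quad u + quad w + symp u w) * (v k).1) =
      ((0, symp v w + quad w * (v k).1) +
        (0, symp v u + (v k).1 * symp u w + quad u * (v k).1) : ZMod 2 × ZMod 2) := by
    ext
    · simp
    · simp only [Prod.snd_add]; ring
  rw [h3, Pi.single_add]
  abel

lemma eichler_single_Z (k j : Fin n) :
    eichler k (Pi.single j (0, 1)) = czMap k j := by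
  ext1 v
  rw [eichler, czMap, symp_single_right, quad_single, ← Pi.single_smul]
  simp only [mul_one, mul_zero, zero_mul, add_zero, Prod.smul_mk, smul_eq_mul]
  abel

lemma eichler_single_X (k j : Fin n) (h : j ≠ k) :
    eichler k (Pi.single j (1, 0)) = hadMap j ∘ czMap k j ∘ hadMap j := by
  have h' := h.symm
  ext1 v
  rw [eichler, symp_single_right, quad_single, ← Pi.single_smul]
  ext1 l
  by_cases hj : l = j
  · subst hj
    simp [hadMap, czMap, h, h']
  · by_cases hk : l = k
    · subst hk
      simp [hadMap, czMap, h, h']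
    · simp [hadMap, czMap, hj, hk]

lemma eichler_zero (k : Fin n) : eichler k 0 = id := by
  ext1 v
  simp [eichler, symp, quad]

lemma eichler_mem_realized (k : Fin n) (u : Phase n) (hu : u k = 0) :
    eichler k u ∈ realized n := by
  suffices h : ∀ u : Phase n, eichler k (Function.update u k 0) ∈ realized n by
    have h' := h u
    rwa [← hu, Function.update_eq_self] at h'
  refine phase_induction ?_ ?_ ?_ ?_
  · have h0 : Function.update (0 : Phase n) k 0 = 0 := Function.update_eq_self k 0
    rw [h0, eichler_zero]
    exact id_mem_realized
  · intro v w hv hw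
    have h0 : Function.update (v + w) k 0 = Function.update v k 0 + Function.update w k 0 := by
      rw [← Function.update_add, add_zero]
    rw [h0, ← eichler_comp _ _ _ (by simp) (by simp)]
    exact realized_comp hv hw
  all_goals
    intro j
    by_cases hj : j = k
    · subst hj
      have h0 : ∀ p, Function.update (Pi.single j p : Phase n) j 0 = 0 := fun p => by
        rw [Pi.single, Function.update_idem]
        exact Function.update_eq_self j 0
      rw [h0, eichler_zero]
      exact id_mem_realized
    · have h0 : ∀ p, Function.update (Pi.single j p : Phase n) k 0 = Pi.single j p := fun p => by
        rw [Function.update_eq_self_iff, Pi.single_eq_of_ne (Ne.symm hj)]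
      rw [h0]
      first
      | rw [eichler_single_X k j hj]
        exact realized_comp (hadMap_mem_realized j)
          (realized_comp (czMap_mem_realized k j (Ne.symm hj)) (hadMap_mem_realized j))
      | rw [eichler_single_Z]
        exact czMap_mem_realized k j (Ne.symm hj)

lemma quad_realized {f : Phase n → Phase n} (hf : f ∈ realized n) (v : Phase n) :
    quad (f v) = quad v := by
  obtain ⟨g, -, hg⟩ := hf
  exact hg.quad_map v

lemma eichler_single (k i : Fin n) (hik : i ≠ k) (u : Phase n) (hu : u i = 0)
    (p : ZMod 2 × ZMod 2) : eichler k u (Pi.single i p) = Pi.single i p := by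
  rw [eichler, symp_comm, symp_single_right, hu, Pi.single_eq_of_ne hik.symm]
  simp

lemma hadMap_single (i j : Fin n) (hij : i ≠ j) (p : ZMod 2 × ZMod 2) :
    hadMap j (Pi.single i p) = Pi.single i p := by
  rw [hadMap, Function.update_eq_self_iff, Pi.single_eq_of_ne hij.symm]
  rfl

/-- An isotropic vector with nonzero `X`-component at `k` is moved to the `X`-vector of qubit `k`
by a realized map fixing the `Z`-vector of `k` and all qubits that the vector does not touch. -/
lemma exists_realized_to_X (k : Fin n) (w : Phase n) (hq : quad w = 0) (hk : (w k).1 = 1) :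
    ∃ f ∈ realized n, f w = Pi.single k (1, 0) ∧
      f (Pi.single k (0, 1)) = Pi.single k (0, 1) ∧
      ∀ i, i ≠ k → w i = 0 → ∀ p, f (Pi.single i p) = Pi.single i p := by
  set u : Phase n := w + Pi.single k (w k) with hu
  have huk : u k = 0 := by
    rw [hu, Pi.add_apply, Pi.single_eq_same]
    exact congrFun (phase_add_self w) k
  have hwu : w + u = Pi.single k (w k) := by
    rw [hu, ← add_assoc, phase_add_self, zero_add]
  refine ⟨eichler k u, eichler_mem_realized k u huk, ?_, ?_, ?_⟩
  · have h1 := quad_add w u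
    rw [hwu, quad_single, hq, zero_add, hk, one_mul] at h1
    rw [eichler, hk, one_smul, hwu, mul_one, add_comm (symp _ _), ← h1, ← Pi.single_add]
    congr 1
    ext
    · simp [hk]
    · exact CharTwo.add_self_eq_zero _
  · rw [eichler, symp_comm, symp_single_right, huk]
    simp
  · intro i hik hi p
    refine eichler_single k i hik u ?_ p
    simp [hu, hi, hik]

/-- A nonzero isotropic vector is moved to the `Z`-vector of qubit `k` by a realized map fixing
all qubits other than `k` that the vector does not touch. -/
lemma exists_realized_to_Z (k : Fin n) (w : Phase n) (hq : quad w = 0) (hw : w ≠ 0) :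
    ∃ f ∈ realized n, f w = Pi.single k (0, 1) ∧
      ∀ i, i ≠ k → w i = 0 → ∀ p, f (Pi.single i p) = Pi.single i p := by
  have hX : ∀ w : Phase n, quad w = 0 → (w k).1 = 1 → ∃ f ∈ realized n,
      f w = Pi.single k (0, 1) ∧
      ∀ i, i ≠ k → w i = 0 → ∀ p, f (Pi.single i p) = Pi.single i p := by
    intro w hq hk
    obtain ⟨f, hf, h1, -, h2⟩ := exists_realized_to_X k w hq hk
    refine ⟨hadMap k ∘ f, realized_comp (hadMap_mem_realized k) hf, ?_, ?_⟩
    · rw [Function.comp_apply, h1, hadMap, Pi.single_eq_same, Pi.single, Function.update_idem]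
      rfl
    · intro i hik hi p
      rw [Function.comp_apply, h2 i hik hi, hadMap_single i k hik]
  have hadStep : ∀ (w : Phase n) (j : Fin n), (j = k ∨ w j ≠ 0) →
      (∃ f ∈ realized n, f (hadMap j w) = Pi.single k (0, 1) ∧
        ∀ i, i ≠ k → hadMap j w i = 0 → ∀ p, f (Pi.single i p) = Pi.single i p) →
      ∃ f ∈ realized n, f w = Pi.single k (0, 1) ∧
        ∀ i, i ≠ k → w i = 0 → ∀ p, f (Pi.single i p) = Pi.single i p := by
    rintro w j hj ⟨f, hf, h1, h2⟩
    refine ⟨f ∘ hadMap j, realized_comp hf (hadMap_mem_realized j), h1, ?_⟩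
    intro i hik hi p
    have hij : i ≠ j := by
      rintro rfl
      exact hj.elim hik fun h => h hi
    rw [Function.comp_apply, hadMap_single i j hij, h2 i hik]
    rw [hadMap, Function.update_of_ne hij, hi]
  have hZ : ∀ w : Phase n, quad w = 0 → (w k).2 = 1 → ∃ f ∈ realized n,
      f w = Pi.single k (0, 1) ∧
      ∀ i, i ≠ k → w i = 0 → ∀ p, f (Pi.single i p) = Pi.single i p := by
    intro w hq hk
    refine hadStep w k (.inl rfl) (hX _ ?_ ?_)
    · rw [quad_realized (hadMap_mem_realized k), hq]
    · simpa [hadMap] using hk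
  rcases zmod_two_cases (w k).1 with hk1 | hk1
  swap
  · exact hX w hq hk1
  rcases zmod_two_cases (w k).2 with hk2 | hk2
  swap
  · exact hZ w hq hk2
  have hC : ∀ (w : Phase n) (j : Fin n), quad w = 0 → w k = 0 → (w j).1 = 1 →
      ∃ f ∈ realized n, f w = Pi.single k (0, 1) ∧
      ∀ i, i ≠ k → w i = 0 → ∀ p, f (Pi.single i p) = Pi.single i p := by
    intro w j hq hk hj
    have hjk : j ≠ k := by
      rintro rfl
      simp [hk] at hj
    have hc := czMap_mem_realized k j hjk.symm
    obtain ⟨f, hf, h1, h2⟩ := hZ (czMap k j w) (by rw [quad_realized hc, hq])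
      (by simp [czMap, hk, hj, hjk.symm])
    refine ⟨f ∘ czMap k j, realized_comp hf hc, h1, ?_⟩
    intro i hik hi p
    have hij : i ≠ j := by
      rintro rfl
      simp [hi] at hj
    have h3 : czMap k j (Pi.single i p) = Pi.single i p := by
      have h0 : ∀ l, (Pi.single l (0, 0) : Phase n) = 0 := fun l => Pi.single_zero l
      simp [czMap, hik.symm, hij.symm, h0]
    rw [Function.comp_apply, h3, h2 i hik]
    simp [czMap, hi, hik, hij]
  have hk : w k = 0 := Prod.ext hk1 hk2
  obtain ⟨j, hj⟩ := Function.ne_iff.1 hw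
  rcases zmod_two_cases (w j).1 with hj1 | hj1
  · have hj2 : (w j).2 = 1 := (zmod_two_cases _).resolve_left fun h => hj (Prod.ext hj1 h)
    have hjk : k ≠ j := by
      rintro rfl
      exact hj hk
    refine hadStep w j (.inr hj) (hC _ j ?_ ?_ ?_)
    · rw [quad_realized (hadMap_mem_realized j), hq]
    · rw [hadMap, Function.update_of_ne hjk, hk]
    · simpa [hadMap] using hj2
  · exact hC w j hq hk hj1

/-- Up to the extended gate group, a Clifford action can be made to fix any set of qubits. -/
lemma exists_fix_finset {U : (Mat n)ˣ} {f : Phase n → Phase n} (hU : IsAct (U : Mat n) f)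
    (T : Finset (Fin n)) :
    ∃ g ∈ ExtGateGroup n, ∃ f', IsAct ((g * U : (Mat n)ˣ) : Mat n) f' ∧
      ∀ i ∈ T, f' (Pi.single i (1, 0)) = Pi.single i (1, 0) ∧
        f' (Pi.single i (0, 1)) = Pi.single i (0, 1) := by
  induction T using Finset.induction_on with
  | empty => exact ⟨1, one_mem _, f, by simpa using hU, by simp⟩
  | insert k T hkT ih =>
    obtain ⟨g, hg, τ, hτ, hT⟩ := ih
    have vanish : ∀ {V : (Mat n)ˣ} {τ : Phase n → Phase n}, IsAct (V : Mat n) τ →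
        (∀ i ∈ T, τ (Pi.single i (1, 0)) = Pi.single i (1, 0) ∧
          τ (Pi.single i (0, 1)) = Pi.single i (0, 1)) →
        ∀ i ∈ T, ∀ p, τ (Pi.single k p) i = 0 := by
      intro V τ hτ hT i hi p
      have hik : i ≠ k := fun h => hkT (h ▸ hi)
      have h1 := hτ.symp_map (Pi.single k p) (Pi.single i (1, 0))
      have h2 := hτ.symp_map (Pi.single k p) (Pi.single i (0, 1))
      rw [(hT i hi).1, symp_single_right, symp_single_right, Pi.single_eq_of_ne hik] at h1
      rw [(hT i hi).2, symp_single_right, symp_single_right, Pi.single_eq_of_ne hik] at h2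
      exact Prod.ext (by simpa using h2) (by simpa using h1)
    have hne : ∀ i ∈ T, i ≠ k := fun i hi h => hkT (h ▸ hi)
    obtain ⟨f₁, ⟨g₁, hg₁, hf₁⟩, hZ₁, hfix₁⟩ := exists_realized_to_Z k (τ (Pi.single k (0, 1)))
      (by rw [hτ.quad_map, quad_single, zero_mul]) (by
        intro h0
        have h1 := hτ.symp_map (Pi.single k (0, 1)) (Pi.single k (1, 0))
        rw [h0, symp_comm 0, symp_single_right, symp] at h1
        simp at h1)
    have hτ₁ : IsAct ((g₁ * (g * U) : (Mat n)ˣ) : Mat n) (f₁ ∘ τ) := hf₁.comp hτ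
    have hT₁ : ∀ i ∈ T, (f₁ ∘ τ) (Pi.single i (1, 0)) = Pi.single i (1, 0) ∧
        (f₁ ∘ τ) (Pi.single i (0, 1)) = Pi.single i (0, 1) := by
      intro i hi
      have h := hfix₁ i (hne i hi) (vanish hτ hT i hi _)
      rw [Function.comp_apply, Function.comp_apply, (hT i hi).1, (hT i hi).2, h, h]
      exact ⟨rfl, rfl⟩
    have hZk : (f₁ ∘ τ) (Pi.single k (0, 1)) = Pi.single k (0, 1) := hZ₁
    obtain ⟨f₂, ⟨g₂, hg₂, hf₂⟩, hX₂, hZ₂, hfix₂⟩ :=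
      exists_realized_to_X k ((f₁ ∘ τ) (Pi.single k (1, 0)))
      (by rw [hτ₁.quad_map, quad_single, mul_zero]) (by
        have h1 := hτ₁.symp_map (Pi.single k (1, 0)) (Pi.single k (0, 1))
        rw [hZk, symp_single_right, symp_single_right] at h1
        simpa using h1)
    refine ⟨g₂ * (g₁ * g), mul_mem hg₂ (mul_mem hg₁ hg), f₂ ∘ (f₁ ∘ τ), ?_, ?_⟩
    · rw [mul_assoc, mul_assoc]
      exact hf₂.comp hτ₁
    · intro i hi
      rw [Function.comp_apply (f := f₂), Function.comp_apply (f := f₂)]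
      rcases Finset.mem_insert.1 hi with rfl | hi
      · exact ⟨hX₂, by rw [hZk, hZ₂]⟩
      · have h := hfix₂ i (hne i hi) (vanish hτ₁ hT₁ i hi _)
        rw [(hT₁ i hi).1, (hT₁ i hi).2, h, h]
        exact ⟨rfl, rfl⟩

lemma exists_isAct_id {U : (Mat n)ˣ} {f : Phase n → Phase n} (hU : IsAct (U : Mat n) f) :
    ∃ g ∈ ExtGateGroup n, IsAct ((g * U : (Mat n)ˣ) : Mat n) id := by
  obtain ⟨g, hg, f', hf', h⟩ := exists_fix_finset hU Finset.univ
  have hid : f' = id := by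
    ext1 v
    induction v using phase_induction with
    | zero =>
      have h0 := hf'.map_add 0 0
      rw [add_zero] at h0
      simpa using h0
    | hadd v w hv hw => rw [hf'.map_add, hv, hw]; rfl
    | x i => exact (h i (Finset.mem_univ i)).1
    | z i => exact (h i (Finset.mem_univ i)).2
  exact ⟨g, hg, hid ▸ hf'⟩

lemma exists_weyl_mem (v : Phase n) :
    ∃ g ∈ ExtGateGroup n, ∃ s, (g : Mat n) = sgn s • weyl v := by
  induction v using phase_induction with
  | zero => exact ⟨1, one_mem _, 0, by simp [weyl_zero]⟩
  | hadd v w hv hw =>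
    obtain ⟨g, hg, s, hs⟩ := hv
    obtain ⟨h, hh, t, ht⟩ := hw
    refine ⟨g * h, mul_mem hg hh, s + t + cocycle v w, ?_⟩
    rw [Units.val_mul, hs, ht, smul_mul_smul_comm, weyl_mul, smul_smul, sgn_add, sgn_add]
  | x i =>
    obtain ⟨z, hz, hz'⟩ := exists_mem_extGateGroup (n := n) (.inr (.inl ⟨i, rfl⟩))
    obtain ⟨h, hh, hh'⟩ := exists_mem_extGateGroup (n := n) (.inl ⟨i, rfl⟩)
    refine ⟨h * z * h, mul_mem (mul_mem hh hz) hh, 0, ?_⟩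
    rw [Units.val_mul, Units.val_mul, hz', hh', weyl_single, gate1, gate1, gate1, tensorN_mul,
      tensorN_mul, sgn_zero, one_smul]
    congr 1
    ext1 j
    split_ifs
    · rw [← pauli_Z, Hmat_mul_pauli]
      simp [mul_assoc, Hmat_mul_self]
    · simp
  | z i =>
    obtain ⟨z, hz, hz'⟩ := exists_mem_extGateGroup (n := n) (.inr (.inl ⟨i, rfl⟩))
    exact ⟨z, hz, 0, by rw [hz', weyl_single, pauli_Z, sgn_zero, one_smul]⟩

lemma mul_weyl_apply (U : Mat n) (v : Phase n) (x y : Fin n → ZMod 2) :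
    (U * weyl v) x y = U x (fun i => y i + (v i).1) * sgn (∑ i, (v i).2 * y i) := by
  change ∑ z : Fin n → ZMod 2, U x z * weyl v z y = _
  rw [Finset.sum_eq_single_of_mem (fun i => y i + (v i).1 : Fin n → ZMod 2) (Finset.mem_univ _)]
  · rw [weyl_apply, if_pos fun _ => rfl]
  · intro z _ hz
    rw [weyl_apply, if_neg fun h => hz (funext h), mul_zero]

lemma weyl_mul_apply (U : Mat n) (v : Phase n) (x y : Fin n → ZMod 2) :
    (weyl v * U) x y =
      sgn (∑ i, (v i).2 * (x i + (v i).1)) * U (fun i => x i + (v i).1) y := by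
  change ∑ z : Fin n → ZMod 2, weyl v x z * U z y = _
  have hv : ∀ i, (v i).1 + (v i).1 = 0 := fun i => CharTwo.add_self_eq_zero _
  rw [Finset.sum_eq_single_of_mem (fun i => x i + (v i).1 : Fin n → ZMod 2) (Finset.mem_univ _)]
  · rw [weyl_apply, if_pos fun i => by rw [add_assoc, hv, add_zero]]
  · intro z _ hz
    rw [weyl_apply, if_neg, zero_mul]
    intro h
    refine hz (funext fun i => ?_)
    rw [h i, add_assoc, hv, add_zero]

/-- The Pauli operators act irreducibly. -/
lemma eq_smul_one_of_commute_weyl (U : Mat n) (h : ∀ v, U * weyl v = weyl v * U) :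
    ∃ c : ℝ, U = c • 1 := by
  have hent : ∀ (v : Phase n) (x y : Fin n → ZMod 2),
      U x (fun i => y i + (v i).1) * sgn (∑ i, (v i).2 * y i) =
        sgn (∑ i, (v i).2 * (x i + (v i).1)) * U (fun i => x i + (v i).1) y := by
    intro v x y
    rw [← mul_weyl_apply, ← weyl_mul_apply, h]
  have hdiag : ∀ x y : Fin n → ZMod 2, x ≠ y → U x y = 0 := by
    intro x y hxy
    obtain ⟨i, hi⟩ := Function.ne_iff.1 hxy
    have h1 := hent (fun j => (0, if j = i then 1 else 0)) x y
    simp only [add_zero, ite_mul, one_mul, zero_mul, Finset.sum_ite_eq', Finset.mem_univ,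
      if_true] at h1
    rw [mul_comm] at h1
    by_contra h0
    exact hi (sgn_injective (mul_right_cancel₀ h0 h1)).symm
  have hconst : ∀ x : Fin n → ZMod 2, U x x = U (0 : Fin n → ZMod 2) (0 : Fin n → ZMod 2) := by
    intro x
    have h1 := hent (fun j => (x j, 0)) x 0
    simp only [zero_mul, Finset.sum_const_zero, sgn_zero, mul_one, one_mul, Pi.zero_apply,
      zero_add, CharTwo.add_self_eq_zero] at h1
    exact h1
  refine ⟨U (0 : Fin n → ZMod 2) (0 : Fin n → ZMod 2), Matrix.ext fun x y => ?_⟩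
  by_cases hxy : x = y
  · subst hxy
    simpa using hconst x
  · simpa [hxy] using hdiag x y hxy

/-- An operator acting trivially on phase space is a Pauli operator up to a scalar. -/
lemma exists_weyl_mul_eq_smul_one {U : (Mat n)ˣ} (hU : IsAct (U : Mat n) id) :
    ∃ q, ∃ c : ℝ, weyl q * (U : Mat n) = c • 1 := by
  obtain ⟨s, hs⟩ := hU
  simp only [id] at hs
  let q : Phase n := fun i => (s (Pi.single i (0, 1)), s (Pi.single i (1, 0)))
  have hq : ∀ v, weyl q * (U : Mat n) * weyl v =
      sgn (symp q v + s v) • (weyl v * (weyl q * (U : Mat n))) := by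
    intro v
    rw [mul_assoc, hs, mul_smul_comm, ← mul_assoc, weyl_mul_comm, smul_mul_assoc, smul_smul,
      sgn_add, mul_comm (sgn (s v)), mul_assoc]
  refine ⟨q, eq_smul_one_of_commute_weyl _ fun v => ?_⟩
  induction v using phase_induction with
  | zero => simp [weyl_zero]
  | hadd v w hv hw =>
    have h1 : weyl q * (U : Mat n) * (weyl v * weyl w) =
        weyl v * weyl w * (weyl q * (U : Mat n)) := by
      rw [← mul_assoc, hv, mul_assoc, hw, ← mul_assoc]
    rw [weyl_mul, mul_smul_comm, smul_mul_assoc] at h1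
    exact smul_right_injective _ (sgn_ne_zero _) h1
  | x i =>
    rw [hq, symp_single_right]
    simp [q, CharTwo.add_self_eq_zero]
  | z i =>
    rw [hq, symp_single_right]
    simp [q, CharTwo.add_self_eq_zero]

lemma exists_isAct_of_mem_CliffordGroup {U : Mat n} (hU : U ∈ CliffordGroup n) :
    ∃ V : (Mat n)ˣ, (V : Mat n) = U ∧ ∃ f, IsAct U f := by
  obtain ⟨ho, hP⟩ := hU
  let V : (Mat n)ˣ := ⟨U, star U, ho.2, ho.1⟩
  refine ⟨V, rfl, ?_⟩
  have h : ∀ v, ∃ s w, U * weyl v = sgn s • (weyl w * U) := by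
    intro v
    obtain ⟨s, w, h⟩ := (mem_PauliGroup_iff _).1
      (hP (weyl v) ((mem_PauliGroup_iff _).2 ⟨0, v, by simp⟩))
    refine ⟨s, w, ?_⟩
    have hV : U⁻¹ = ((V⁻¹ : (Mat n)ˣ) : Mat n) := Matrix.coe_units_inv V |>.symm
    rw [← smul_mul_assoc, ← h, hV]
    exact (Units.inv_mul_cancel_right _ V).symm
  choose s f hf using h
  exact ⟨f, s, hf⟩

lemma mem_CliffordGroup_of_isAct {U : (Mat n)ˣ}
    (ho : (U : Mat n) ∈ Matrix.orthogonalGroup (Fin n → Fin 2) ℝ)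
    {f : Phase n → Phase n} (hf : IsAct (U : Mat n) f) : (U : Mat n) ∈ CliffordGroup n := by
  obtain ⟨s, hs⟩ := hf
  refine ⟨ho, fun P hP => ?_⟩
  obtain ⟨t, v, rfl⟩ := (mem_PauliGroup_iff _).1 hP
  refine (mem_PauliGroup_iff _).2 ⟨t + s v, f v, ?_⟩
  rw [mul_smul_comm, hs, ← Matrix.coe_units_inv, smul_smul, smul_mul_assoc,
    Units.mul_inv_cancel_right, sgn_add]

/-- The real Clifford group `C_n` coincides with the extended
gate group `G_n'` (viewed as a set of matrices). -/
theorem clifford_eq_extGateGroup (n : ℕ) :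
    CliffordGroup n = Units.val '' (ExtGateGroup n : Set (Mat n)ˣ) := by
  ext U
  constructor
  · intro hU
    obtain ⟨V, rfl, f, hf⟩ := exists_isAct_of_mem_CliffordGroup hU
    obtain ⟨g, hg, hgV⟩ := exists_isAct_id hf
    obtain ⟨q, c, hc⟩ := exists_weyl_mul_eq_smul_one hgV
    obtain ⟨w, hw, s, hs⟩ := exists_weyl_mem q
    have hwgV : ((w * (g * V) : (Mat n)ˣ) : Mat n) = (sgn s * c) • 1 := by
      rw [Units.val_mul, hs, smul_mul_assoc, hc, smul_smul]
    have hO : ((w * (g * V) : (Mat n)ˣ) : Mat n) ∈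
        Matrix.orthogonalGroup (Fin n → Fin 2) ℝ :=
      mul_mem (extGateGroup_spec hw).1 (mul_mem (extGateGroup_spec hg).1 hU.1)
    have hsq : (sgn s * c) * (sgn s * c) = 1 := by
      have h1 := hO.2
      rw [hwgV] at h1
      have h2 := congrFun (congrFun h1 0) 0
      simpa using h2
    have hmem : w * (g * V) ∈ ExtGateGroup n := by
      rcases mul_self_eq_one_iff.1 hsq with h | h
      · have h1 : w * (g * V) = 1 := Units.ext (by rw [hwgV, h, one_smul, Units.val_one])
        exact h1 ▸ one_mem _
      · have h1 : w * (g * V) = -1 :=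
          Units.ext (by rw [hwgV, h, neg_one_smul, Units.val_neg, Units.val_one])
        exact h1 ▸ neg_one_mem_extGateGroup
    exact ⟨V, (Subgroup.mul_mem_cancel_left _ hg).1
      ((Subgroup.mul_mem_cancel_left _ hw).1 hmem), rfl⟩
  · rintro ⟨V, hV, rfl⟩
    obtain ⟨ho, f, hf⟩ := extGateGroup_spec hV
    exact mem_CliffordGroup_of_isAct ho hf

end RealStab

end
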